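/- Let N ≥ 3 and k ≥ 3 be integers and let v be any vertex of the box product γ_k □ γ_N of a k-cycle and an N-cycle. Let G be the graph obtained from γ_k □ γ_N by deleting v (a decompleted non-skew toroidal grid constructed from N-cycles, which has kN − 1 ≥ 3N − 1 vertices). Then the number of points x ∈ 𝔽₂^{E(G)} with Ψ_G(x) = 0 is congruent to 0 modulo 8; equivalently, c₂^{(2)}(G) = 0. -/

import Mathlib

open SimpleGraph
open scoped Classical

/-- The cycle graph on `ZMod n`: distinct `i, j` are adjacent iff `i - j = ±1`. -/
def cycleGraph' (n : ℕ) : SimpleGraph (ZMod n) :=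
  SimpleGraph.fromRel (fun i j => i - j = 1)

/-- `T` is (the edge set of) a spanning tree of `G`. -/
def IsSpanningTree {V : Type} (G : SimpleGraph V) (T : Set (Sym2 V)) : Prop :=
  T ⊆ G.edgeSet ∧ (SimpleGraph.fromEdgeSet T).Connected ∧
    (SimpleGraph.fromEdgeSet T).IsAcyclic

/-- The Kirchhoff polynomial `Ψ_G = Σ_T ∏_{e ∉ T} α_e`, summed over spanning trees. -/
noncomputable def kirchhoff {V : Type} [Fintype V] (G : SimpleGraph V) :
    MvPolynomial G.edgeSet ℤ :=
  ∑ T ∈ G.edgeFinset.powerset.filter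
      (fun T : Finset (Sym2 V) => IsSpanningTree G (T : Set (Sym2 V))),
    ∏ e : G.edgeSet, if (e : Sym2 V) ∈ T then 1 else MvPolynomial.X e

/-- `[Ψ_G]_p`: the number of points `x ∈ 𝔽_p^{E(G)}` with `Ψ_G(x) = 0`. -/
noncomputable def zeroCount {V : Type} [Fintype V] (G : SimpleGraph V) (p : ℕ) : ℕ :=
  Nat.card {x : G.edgeSet → ZMod p //
    MvPolynomial.eval x (MvPolynomial.map (Int.castRingHom (ZMod p)) (kirchhoff G)) = 0}

section RootedForests

open Finset Matrix

variable {V E : Type} [Fintype V] [Fintype E]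

/-- The mod-2 incidence matrix of the multigraph with endpoint maps `s` and `t`. -/
noncomputable def incidence (s t : E → V) : Matrix E V (ZMod 2) :=
  Matrix.of fun e x => (if s e = x then 1 else 0) + (if t e = x then 1 else 0)

/-- Every vertex is joined to a root in `I` by edges of `S`: a `ZMod 2`-valued potential that is
constant along `S` and vanishes on `I` is zero. -/
def SpansFrom (s t : E → V) (S : Finset E) (I : Finset V) : Prop :=
  ∀ φ : V → ZMod 2, (∀ e ∈ S, φ (s e) = φ (t e)) → (∀ x ∈ I, φ x = 0) → φ = 0

/-- Spanning forests in which every component contains exactly one root of `I`. -/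
noncomputable def rootedForests (s t : E → V) (I : Finset V) : Finset (Finset E) :=
  Finset.univ.filter fun S => S.card + I.card = Fintype.card V ∧ SpansFrom s t S I

/-- The dual generating function `Σ_S ∏_{e ∉ S} y_e` of a family of edge sets. -/
noncomputable def coWeight (F : Finset (Finset E)) (y : E → ZMod 2) : ZMod 2 :=
  ∑ S ∈ F, ∏ e ∈ Sᶜ, y e

lemma ZMod.two_eq_one_of_ne_zero {a : ZMod 2} (h : a ≠ 0) : a = 1 := by
  revert a; decide

lemma Fintype.sum_subtype_of_zero {ι M : Type*} [Fintype ι] [AddCommMonoid M] (p : ι → Prop)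
    [Fintype {x // p x}] (f : ι → M) (h : ∀ x, ¬ p x → f x = 0) :
    ∑ x : {x // p x}, f x = ∑ x, f x := by
  rw [← Finset.sum_subtype (Finset.univ.filter p) (by simp) f]
  exact Finset.sum_subset (Finset.subset_univ _) fun x _ hx => h x (by simpa using hx)

lemma Matrix.mulVec_injective_iff_ker {m n : Type*} [Fintype n] (A : Matrix m n (ZMod 2)) :
    Function.Injective A.mulVec ↔ ∀ v, A *ᵥ v = 0 → v = 0 :=
  injective_iff_map_eq_zero A.mulVecLin

omit [Fintype E] in
lemma incidence_mulVec (s t : E → V) (φ : V → ZMod 2) (e : E) :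
    (incidence s t *ᵥ φ) e = φ (s e) + φ (t e) := by
  simp [incidence, Matrix.mulVec, dotProduct, add_mul, Finset.sum_add_distrib]

lemma Matrix.det_diagonal_block_expand (y : E → ZMod 2) (B : Matrix E V (ZMod 2))
    (C : Matrix V E (ZMod 2)) (D : Matrix V V (ZMod 2)) :
    (fromBlocks (diagonal y) B C D).det = ∑ S : Finset E, (∏ e ∈ Sᶜ, y e) *
      (fromBlocks (diagonal fun e => if e ∈ S then 0 else 1)
        (Matrix.of fun e x => if e ∈ S then B e x else 0) C D).det := by
  have hsplit : fromBlocks (diagonal y) B C D =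
      fromBlocks 0 B C D + fromBlocks (diagonal y) 0 0 0 := by
    rw [fromBlocks_add]; simp
  have hexp := (detRowAlternating (n := E ⊕ V) (R := ZMod 2)).map_add_univ
    (fromBlocks 0 B C D) (fromBlocks (diagonal y) 0 0 0)
  have hdet : ∀ M : Matrix (E ⊕ V) (E ⊕ V) (ZMod 2), detRowAlternating M = M.det := fun _ => rfl
  rw [hsplit, ← hdet]
  refine hexp.trans ?_
  symm
  refine Finset.sum_of_injOn (fun S : Finset E => S.disjSum (Finset.univ : Finset V)) ?_ ?_ ?_ ?_
  · intro S _ S' _ h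
    ext e
    have := congrArg (fun u => Sum.inl e ∈ u) h
    simpa using this
  · intro S _; simp
  · intro u _ hu
    by_cases h : ∀ x, Sum.inr x ∈ u
    · exfalso
      apply hu
      refine ⟨Finset.univ.filter fun e => Sum.inl e ∈ u, by simp, ?_⟩
      ext (e | x) <;> simp [h]
    · push Not at h
      obtain ⟨x, hx⟩ := h
      refine Matrix.det_eq_zero_of_row_eq_zero (Sum.inr x) ?_
      intro j
      refine (congrFun (Finset.piecewise_eq_of_notMem u (fromBlocks 0 B C D)
        (fromBlocks (diagonal y) 0 0 0) hx) j).trans ?_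
      cases j <;> simp [fromBlocks]
  · intro S _
    rw [← hdet]
    have := (detRowAlternating (n := E ⊕ V) (R := ZMod 2)).map_piecewise_smul
      (Sum.elim y fun _ => 1)
      (fromBlocks (diagonal fun e => if e ∈ S then 0 else 1)
        (Matrix.of fun e x => if e ∈ S then B e x else 0) C D) (Sᶜ.map Function.Embedding.inl)
    rw [Finset.prod_map] at this
    refine Eq.trans ?_ (this.symm.trans ?_)
    · simp
    · refine congrArg Matrix.det ?_
      ext (e | x) j
      · by_cases he : e ∈ S <;> rcases j with e' | x' <;>
          simp [Finset.piecewise, fromBlocks, diagonal, he]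
      · rcases j with e' | x' <;> simp [Finset.piecewise, fromBlocks]

/-- Injectivity of the transposed incidence map restricted to `S` and to the non-roots. -/
def CospansFrom (s t : E → V) (S : Finset E) (I : Finset V) : Prop :=
  ∀ l : E → ZMod 2, (∀ e ∉ S, l e = 0) → (∀ x ∉ I, (l ᵥ* incidence s t) x = 0) → l = 0

/-- The incidence matrix with rows restricted to `S` and columns restricted to the non-roots. -/
noncomputable def restrictedIncidence (s t : E → V) (S : Finset E) (I : Finset V) :
    Matrix S {x // x ∉ I} (ZMod 2) :=
  (incidence s t).submatrix Subtype.val Subtype.val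

omit [Fintype E] in
lemma restrictedIncidence_mulVec (s t : E → V) (S : Finset E) (I : Finset V) (φ : V → ZMod 2)
    (hφ : ∀ x ∈ I, φ x = 0) (e : S) :
    (restrictedIncidence s t S I *ᵥ fun x => φ x) e = φ (s e) + φ (t e) := by
  rw [← incidence_mulVec]
  simp only [Matrix.mulVec, dotProduct, restrictedIncidence, submatrix_apply]
  exact Fintype.sum_subtype_of_zero (· ∉ I) (fun x => incidence s t e x * φ x)
    fun x hx => by simp [hφ x (not_not.mp hx)]

omit [Fintype V] in
lemma restrictedIncidence_transpose_mulVec (s t : E → V) (S : Finset E) (I : Finset V)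
    (l : E → ZMod 2) (hl : ∀ e ∉ S, l e = 0) (x : {x // x ∉ I}) :
    ((restrictedIncidence s t S I)ᵀ *ᵥ fun e => l e) x = (l ᵥ* incidence s t) x := by
  simp only [Matrix.mulVec, Matrix.vecMul, dotProduct, restrictedIncidence, submatrix_apply,
    transpose_apply]
  refine (Fintype.sum_subtype_of_zero (· ∈ S) (fun e => incidence s t e x * l e)
    fun e he => by simp [hl e he]).trans ?_
  simp only [mul_comm]

omit [Fintype E] in
lemma spansFrom_iff_rank (s t : E → V) (S : Finset E) (I : Finset V) :
    SpansFrom s t S I ↔ (restrictedIncidence s t S I).rank + I.card = Fintype.card V := by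
  have hcard : Fintype.card {x // x ∉ I} + I.card = Fintype.card V := by
    rw [Fintype.card_subtype_compl, Fintype.card_coe]
    exact Nat.sub_add_cancel (Finset.card_le_univ I)
  have hrank : (restrictedIncidence s t S I).rank + I.card = Fintype.card V ↔
      Fintype.card {x // x ∉ I} = (Set.range (restrictedIncidence s t S I).col).finrank (ZMod 2) := by
    rw [← hcard, Matrix.rank_eq_finrank_span_cols, Set.finrank]
    omega
  rw [hrank, ← linearIndependent_iff_card_eq_finrank_span, ← Matrix.mulVec_injective_iff]
  rw [Matrix.mulVec_injective_iff_ker]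
  constructor
  · intro h v hv
    have hext : ∀ x : {x // x ∉ I}, (if h : (x : V) ∉ I then v ⟨x, h⟩ else 0) = v x := by
      intro x; simp [x.2]
    have hzero := h (fun x => if h : x ∉ I then v ⟨x, h⟩ else 0) (fun e he => ?_)
      (fun x hx => by simp [hx])
    · funext x
      rw [← hext x]
      exact congrFun hzero x
    · have := restrictedIncidence_mulVec s t S I (fun x => if h : x ∉ I then v ⟨x, h⟩ else 0)
        (fun x hx => by simp [hx]) ⟨e, he⟩
      simp only [hext] at this
      rw [hv] at this
      exact CharTwo.add_eq_zero.mp this.symm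
  · intro h φ hS hI
    have := h (fun x => φ x) (by
      funext e
      rw [restrictedIncidence_mulVec s t S I φ hI e]
      exact CharTwo.add_eq_zero.mpr (hS e e.2))
    funext x
    by_cases hx : x ∈ I
    · exact hI x hx
    · exact congrFun this ⟨x, hx⟩

lemma cospansFrom_iff_rank (s t : E → V) (S : Finset E) (I : Finset V) :
    CospansFrom s t S I ↔ (restrictedIncidence s t S I).rank = S.card := by
  have hrank : (restrictedIncidence s t S I).rank = S.card ↔
      Fintype.card S = (Set.range (restrictedIncidence s t S I)ᵀ.col).finrank (ZMod 2) := by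
    rw [← Matrix.rank_transpose, Matrix.rank_eq_finrank_span_cols, Set.finrank, Fintype.card_coe]
    omega
  rw [hrank, ← linearIndependent_iff_card_eq_finrank_span, ← Matrix.mulVec_injective_iff]
  rw [Matrix.mulVec_injective_iff_ker]
  constructor
  · intro h v hv
    have hext : ∀ e : S, (if h : (e : E) ∈ S then v ⟨e, h⟩ else 0) = v e := by
      intro e; simp
    have hzero := h (fun e => if h : e ∈ S then v ⟨e, h⟩ else 0) (fun e he => by simp [he])
      (fun x hx => ?_)
    · funext e
      rw [← hext e]
      exact congrFun hzero e
    · have := restrictedIncidence_transpose_mulVec s t S I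
        (fun e => if h : e ∈ S then v ⟨e, h⟩ else 0) (fun e he => by simp [he]) ⟨x, hx⟩
      simp only [hext] at this
      rw [hv] at this
      exact this.symm
  · intro h l hS hI
    have := h (fun e => l e) (by
      funext x
      rw [restrictedIncidence_transpose_mulVec s t S I l hS x]
      exact hI x x.2)
    funext e
    by_cases he : e ∈ S
    · exact congrFun this ⟨e, he⟩
    · exact hS e he

omit [Fintype E] in
lemma SpansFrom.card_le {s t : E → V} {S : Finset E} {I : Finset V} (h : SpansFrom s t S I) :
    Fintype.card V ≤ S.card + I.card := by
  rw [spansFrom_iff_rank] at h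
  have := (restrictedIncidence s t S I).rank_le_card_height
  rw [Fintype.card_coe] at this
  omega

/-- Nonsingularity over `ZMod 2` of the bordered matrix whose determinant enumerates the common
rooted forests of `I` and of its image under `ρ`. -/
def BorderedNonsingular (s t : E → V) (y : E → ZMod 2) (I J : Finset V) : Prop :=
  ∀ (l : E → ZMod 2) (φ : V → ZMod 2), (∀ e, y e * l e = φ (s e) + φ (t e)) →
    (∀ x ∈ J, φ x = 0) → (∀ x ∉ I, (l ᵥ* incidence s t) x = 0) → l = 0 ∧ φ = 0

/-- The bordered matrix with diagonal block `y`. -/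
noncomputable def borderedMatrix (s t : E → V) (d : E → ZMod 2) (B : Matrix E V (ZMod 2))
    (I : Finset V) (ρ : Equiv.Perm V) : Matrix (E ⊕ V) (E ⊕ V) (ZMod 2) :=
  fromBlocks (diagonal d) B (Matrix.of fun x e => if x ∈ I then 0 else incidence s t e x)
    (Matrix.of fun x x' => if x ∈ I ∧ x' = ρ x then 1 else 0)

lemma borderedMatrix_det_ne_zero_iff (s t : E → V) (d : E → ZMod 2) (B : Matrix E V (ZMod 2))
    (I : Finset V) (ρ : Equiv.Perm V) :
    (borderedMatrix s t d B I ρ).det ≠ 0 ↔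
      ∀ (l : E → ZMod 2) (φ : V → ZMod 2), (∀ e, d e * l e = (B *ᵥ φ) e) →
        (∀ x ∈ I.map ρ.toEmbedding, φ x = 0) → (∀ x ∉ I, (l ᵥ* incidence s t) x = 0) →
        l = 0 ∧ φ = 0 := by
  have hker : ∀ (l : E → ZMod 2) (φ : V → ZMod 2),
      borderedMatrix s t d B I ρ *ᵥ Sum.elim l φ = 0 ↔ (∀ e, d e * l e = (B *ᵥ φ) e) ∧
        (∀ x ∈ I.map ρ.toEmbedding, φ x = 0) ∧ (∀ x ∉ I, (l ᵥ* incidence s t) x = 0) := by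
    intro l φ
    have hinl : ∀ e, (borderedMatrix s t d B I ρ *ᵥ Sum.elim l φ) (Sum.inl e) =
        d e * l e + (B *ᵥ φ) e := by
      intro e
      simp [borderedMatrix, fromBlocks_mulVec, mulVec_diagonal]
    have hinr : ∀ x, (borderedMatrix s t d B I ρ *ᵥ Sum.elim l φ) (Sum.inr x) =
        if x ∈ I then φ (ρ x) else (l ᵥ* incidence s t) x := by
      intro x
      by_cases hx : x ∈ I <;>
        simp [borderedMatrix, Matrix.mulVec, Matrix.vecMul, dotProduct, hx,
          mul_comm]
    rw [funext_iff, Sum.forall]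
    simp only [hinl, hinr, Pi.zero_apply, CharTwo.add_eq_zero]
    refine and_congr_right fun _ => ?_
    constructor
    · intro h
      refine ⟨?_, fun x hx => by simpa [hx] using h x⟩
      simp only [Finset.mem_map, forall_exists_index, and_imp]
      rintro _ x hx rfl
      simpa [hx] using h x
    · rintro ⟨h1, h2⟩ x
      by_cases hx : x ∈ I
      · simpa [hx] using h1 (ρ x) (by simpa using hx)
      · simpa [hx] using h2 x hx
  rw [Ne, ← Matrix.exists_mulVec_eq_zero_iff, not_exists]
  constructor
  · intro h l φ h1 h2 h3
    have h4 : Sum.elim l φ = 0 := by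
      by_contra h0
      exact h _ ⟨h0, (hker l φ).mpr ⟨h1, h2, h3⟩⟩
    exact ⟨funext fun e => congrFun h4 (Sum.inl e), funext fun x => congrFun h4 (Sum.inr x)⟩
  · rintro h v ⟨hv, hv'⟩
    rw [← Sum.elim_comp_inl_inr v] at hv'
    obtain ⟨h1, h2, h3⟩ := (hker _ _).mp hv'
    obtain ⟨h4, h5⟩ := h _ _ h1 h2 h3
    apply hv
    rw [← Sum.elim_comp_inl_inr v, h4, h5]
    funext i
    rcases i with _ | _ <;> rfl

lemma borderedMatrix_restrict_det_ne_zero_iff (s t : E → V) (S : Finset E) (I : Finset V)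
    (ρ : Equiv.Perm V) :
    (borderedMatrix s t (fun e => if e ∈ S then 0 else 1)
      (Matrix.of fun e x => if e ∈ S then incidence s t e x else 0) I ρ).det ≠ 0 ↔
      S ∈ rootedForests s t I ∩ rootedForests s t (I.map ρ.toEmbedding) := by
  have hB : ∀ (φ : V → ZMod 2) (e : E),
      ((Matrix.of fun e x => if e ∈ S then incidence s t e x else 0) *ᵥ φ) e =
        if e ∈ S then φ (s e) + φ (t e) else 0 := by
    intro φ e
    rw [← incidence_mulVec]
    by_cases he : e ∈ S <;> simp [Matrix.mulVec, dotProduct, he]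
  have hsplit : (borderedMatrix s t (fun e => if e ∈ S then 0 else 1)
      (Matrix.of fun e x => if e ∈ S then incidence s t e x else 0) I ρ).det ≠ 0 ↔
      SpansFrom s t S (I.map ρ.toEmbedding) ∧ CospansFrom s t S I := by
    rw [borderedMatrix_det_ne_zero_iff]
    simp only [hB]
    constructor
    · intro h
      refine ⟨fun φ h1 h2 => (h 0 φ (fun e => ?_) h2 (by simp)).2,
        fun l h1 h2 => (h l 0 (fun e => ?_) (by simp) h2).1⟩
      · by_cases he : e ∈ S
        · simp [he, h1 e he, CharTwo.add_self_eq_zero]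
        · simp [he]
      · by_cases he : e ∈ S <;> simp [he, h1]
    · rintro ⟨h1, h2⟩ l φ h3 h4 h5
      refine ⟨h2 l (fun e he => by simpa [he] using h3 e) h5, h1 φ (fun e he => ?_) h4⟩
      have := h3 e
      simp only [he, if_true, zero_mul] at this
      exact CharTwo.add_eq_zero.mp this.symm
  rw [hsplit]
  simp only [rootedForests, Finset.mem_inter, Finset.mem_filter, Finset.mem_univ, true_and,
    Finset.card_map]
  rw [spansFrom_iff_rank s t S I, cospansFrom_iff_rank]
  constructor
  · rintro ⟨h1, h2⟩
    have h3 := h1.card_le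
    rw [Finset.card_map] at h3
    have h4 : (restrictedIncidence s t S I).rank ≤ _ := Matrix.rank_le_card_width _
    rw [Fintype.card_subtype_compl, Fintype.card_coe] at h4
    have h5 := Finset.card_le_univ I
    exact ⟨⟨by omega, by omega⟩, by omega, h1⟩
  · rintro ⟨⟨h1, h2⟩, -, h3⟩
    exact ⟨h3, by omega⟩

/-- The parity of the number of common rooted forests containing `{e | y e = 0}` detects
nonsingularity of the bordered matrix. -/
lemma coWeight_inter_ne_zero_iff (s t : E → V) (y : E → ZMod 2) (I : Finset V)
    (ρ : Equiv.Perm V) :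
    coWeight (rootedForests s t I ∩ rootedForests s t (I.map ρ.toEmbedding)) y ≠ 0 ↔
      BorderedNonsingular s t y I (I.map ρ.toEmbedding) := by
  have hdet : coWeight (rootedForests s t I ∩ rootedForests s t (I.map ρ.toEmbedding)) y =
      (borderedMatrix s t y (incidence s t) I ρ).det := by
    rw [borderedMatrix, Matrix.det_diagonal_block_expand, coWeight, ← Finset.sum_subset
      (Finset.subset_univ (rootedForests s t I ∩ rootedForests s t (I.map ρ.toEmbedding)))]
    · refine Finset.sum_congr rfl fun S hS => ?_
      have := ZMod.two_eq_one_of_ne_zero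
        ((borderedMatrix_restrict_det_ne_zero_iff s t S I ρ).mpr hS)
      rw [borderedMatrix] at this
      rw [this, mul_one]
    · intro S _ hS
      have := not_not.mp (mt (borderedMatrix_restrict_det_ne_zero_iff s t S I ρ).mp hS)
      rw [borderedMatrix] at this
      rw [this, mul_zero]
  rw [hdet, borderedMatrix_det_ne_zero_iff]
  simp only [incidence_mulVec, BorderedNonsingular]

lemma coWeight_ne_zero_iff (s t : E → V) (y : E → ZMod 2) (I : Finset V) :
    coWeight (rootedForests s t I) y ≠ 0 ↔ BorderedNonsingular s t y I I := by
  simpa using coWeight_inter_ne_zero_iff s t y I (Equiv.refl V)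

lemma coWeight_pair_inter_ne_zero_iff (s t : E → V) (y : E → ZMod 2) {p q r : V} (hpr : p ≠ r)
    (hqr : q ≠ r) :
    coWeight (rootedForests s t {p, r} ∩ rootedForests s t {q, r}) y ≠ 0 ↔
      BorderedNonsingular s t y {p, r} {q, r} := by
  have h := coWeight_inter_ne_zero_iff s t y {p, r} (Equiv.swap p q)
  simpa [Finset.map_insert, Equiv.swap_apply_of_ne_of_ne hpr.symm hqr.symm] using h

omit [Fintype V] in
lemma BorderedNonsingular.exchange {s t : E → V} {y : E → ZMod 2} {p q r : V} {I : Finset V}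
    (hr : r ∈ I) {l : E → ZMod 2} {φ : V → ZMod 2} (h : ∀ e, y e * l e = φ (s e) + φ (t e))
    (hφr : φ r = 0) (hl : ∀ x ≠ r, (l ᵥ* incidence s t) x = 0) (hφp : φ p = 1) (hφq : φ q = 1)
    (hI : BorderedNonsingular s t y I {q, r}) : BorderedNonsingular s t y I {p, r} := by
  intro l' ψ h1 h2 h3
  simp only [Finset.mem_insert, Finset.mem_singleton, forall_eq_or_imp, forall_eq] at h2
  by_cases hq : ψ q = 0
  · exact hI l' ψ h1 (by simp [hq, h2.2]) h3
  · have h4 := (hI (l' + l) (ψ + φ) (fun e => ?_) ?_ (fun x hx => ?_)).2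
    · have h5 := congrFun h4 p
      simp [h2.1, hφp] at h5
    · simp only [Pi.add_apply, mul_add, h1, h]
      ring
    · simp [ZMod.two_eq_one_of_ne_zero hq, hφq, h2.2, hφr, CharTwo.add_self_eq_zero]
    · rw [Matrix.add_vecMul, Pi.add_apply, h3 x hx, hl x (fun h => hx (h ▸ hr)), add_zero]

/-- A weak form of the Dodgson identity for spanning forest polynomials. -/
lemma coWeight_pair_mul_of_eq_zero (s t : E → V) (y : E → ZMod 2) {p q r : V} (hpr : p ≠ r)
    (hqr : q ≠ r) (h0 : coWeight (rootedForests s t {r}) y = 0) :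
    coWeight (rootedForests s t {p, r}) y * coWeight (rootedForests s t {q, r}) y =
      coWeight (rootedForests s t {p, r} ∩ rootedForests s t {q, r}) y := by
  have hpp := coWeight_ne_zero_iff s t y {p, r}
  have hqq := coWeight_ne_zero_iff s t y {q, r}
  have hpq := coWeight_pair_inter_ne_zero_iff s t y hpr hqr
  have hqp := coWeight_pair_inter_ne_zero_iff s t y hqr hpr
  rw [Finset.inter_comm] at hqp
  have hsing := not_not.mpr h0
  rw [← Ne, coWeight_ne_zero_iff] at hsing
  simp only [BorderedNonsingular, not_forall] at hsing
  obtain ⟨l, φ, h1, h2, h3, h4⟩ := hsing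
  have hφr : φ r = 0 := h2 r (by simp)
  have hl : ∀ x ≠ r, (l ᵥ* incidence s t) x = 0 := fun x hx => h3 x (by simpa using hx)
  have hsub : ∀ u w, φ u = 0 → ¬ BorderedNonsingular s t y {w, r} {u, r} := by
    intro u w hu h
    refine h4 (h l φ h1 (by simp [hu, hφr]) fun x hx => hl x ?_)
    rintro rfl
    simp at hx
  have key : (BorderedNonsingular s t y {p, r} {p, r} ∧ BorderedNonsingular s t y {q, r} {q, r}) ↔
      BorderedNonsingular s t y {p, r} {q, r} := by
    have hsymm := hpq.symm.trans hqp
    by_cases hp : φ p = 0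
    · have := hsub p p hp
      have := hsub p q hp
      tauto
    · by_cases hq : φ q = 0
      · have := hsub q q hq
        have := hsub q p hq
        tauto
      · have hp' := ZMod.two_eq_one_of_ne_zero hp
        have hq' := ZMod.two_eq_one_of_ne_zero hq
        constructor
        · rintro ⟨h5, -⟩
          exact h5.exchange (by simp) h1 hφr hl hq' hp'
        · intro h5
          exact ⟨h5.exchange (by simp) h1 hφr hl hp' hq',
            (hsymm.mp h5).exchange (by simp) h1 hφr hl hq' hp'⟩
  rw [← hpp, ← hqq, ← hpq, ← mul_ne_zero_iff] at key
  generalize coWeight (rootedForests s t {p, r}) y * coWeight (rootedForests s t {q, r}) y = a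
    at key ⊢
  generalize coWeight (rootedForests s t {p, r} ∩ rootedForests s t {q, r}) y = b at key ⊢
  revert a b
  decide

omit [Fintype V] [Fintype E] in
lemma SpansFrom.singleton {s t : E → V} {S : Finset E} {p : V} (h : SpansFrom s t S {p}) (q : V) :
    SpansFrom s t S {q} := by
  intro φ h1 h2
  have h3 := h (fun x => φ x + φ p) (fun e he => by simp [h1 e he])
    (by simp [CharTwo.add_self_eq_zero])
  have h4 : ∀ x, φ x = φ p := fun x => CharTwo.add_eq_zero.mp (congrFun h3 x)
  funext x
  rw [h4 x, ← h4 q]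
  exact h2 q (by simp)

lemma rootedForests_singleton (s t : E → V) (p q : V) :
    rootedForests s t {p} = rootedForests s t {q} := by
  ext S
  simp only [rootedForests, Finset.mem_filter, Finset.card_singleton]
  exact and_congr_right fun _ => and_congr_right fun _ => ⟨fun h => h.singleton q,
    fun h => h.singleton p⟩

lemma rootedForests_empty [Nonempty V] (s t : E → V) : rootedForests s t ∅ = ∅ := by
  refine Finset.filter_eq_empty_iff.mpr ?_
  rintro S - ⟨-, h⟩
  have h1 := congrFun (h 1 (by simp) (by simp)) (Classical.arbitrary V)
  simp at h1

omit [Fintype E] in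
/-- The vertices of a two-component spanning forest form two colour classes: if it separates `p`
from `q`, it separates `r` from exactly one of them. -/
lemma SpansFrom.pair_xor {s t : E → V} {S : Finset E} (hS : S.card + 2 = Fintype.card V)
    {p q : V} (h : SpansFrom s t S {p, q}) (r : V) :
    ¬ (SpansFrom s t S {p, r} ↔ SpansFrom s t S {q, r}) := by
  have hnot : ¬ SpansFrom s t S {p} := fun h' => by
    have := h'.card_le
    rw [Finset.card_singleton] at this
    omega
  simp only [SpansFrom, not_forall] at hnot
  obtain ⟨φ, h1, h2, h3⟩ := hnot
  have hφp : φ p = 0 := h2 p (by simp)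
  have hφq : φ q = 1 := ZMod.two_eq_one_of_ne_zero fun h4 => h3 (h φ h1 (by simp [hφp, h4]))
  by_cases hr : φ r = 0
  · refine fun hiff => h3 (hiff.mpr ?_ φ h1 (by simp [hφp, hr]))
    intro ψ h4 h5
    simp only [Finset.mem_insert, Finset.mem_singleton, forall_eq_or_imp, forall_eq] at h5
    by_cases hp : ψ p = 0
    · exact h ψ h4 (by simp [hp, h5.1])
    · have h6 := h (ψ + φ + 1) (fun e he => by simp [h1 e he, h4 e he])
        (by simp [ZMod.two_eq_one_of_ne_zero hp, hφp, hφq, h5.1, CharTwo.add_self_eq_zero])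
      have h7 := congrFun h6 r
      simp [h5.2, hr] at h7
  · have hr' := ZMod.two_eq_one_of_ne_zero hr
    have hne : ¬ SpansFrom s t S {q, r} := fun h4 => by
      have h5 := congrFun (h4 (φ + 1) (fun e he => by simp [h1 e he])
        (by simp [hφq, hr', CharTwo.add_self_eq_zero])) p
      simp [hφp] at h5
    refine fun hiff => hne (hiff.mp ?_)
    intro ψ h4 h5
    simp only [Finset.mem_insert, Finset.mem_singleton, forall_eq_or_imp, forall_eq] at h5
    by_cases hq : ψ q = 0
    · exact h ψ h4 (by simp [hq, h5.1])
    · have h6 := h (ψ + φ) (fun e he => by simp [h1 e he, h4 e he])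
        (by simp [ZMod.two_eq_one_of_ne_zero hq, hφp, hφq, h5.1, CharTwo.add_self_eq_zero])
      have h7 := congrFun h6 r
      simp [h5.2, hr'] at h7

lemma coWeight_eq_sum_ite (F : Finset (Finset E)) (y : E → ZMod 2) :
    coWeight F y = ∑ S, if S ∈ F then ∏ e ∈ Sᶜ, y e else 0 := by
  simp [coWeight]

lemma coWeight_pair_add (s t : E → V) (y : E → ZMod 2) {p q r : V} (hpq : p ≠ q) (hpr : p ≠ r)
    (hqr : q ≠ r) :
    coWeight (rootedForests s t {p, q}) y + coWeight (rootedForests s t {p, r}) y +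
      coWeight (rootedForests s t {q, r}) y = 0 := by
  simp only [coWeight_eq_sum_ite, ← Finset.sum_add_distrib]
  refine Finset.sum_eq_zero fun S _ => ?_
  simp only [rootedForests, Finset.mem_filter, Finset.mem_univ, true_and,
    Finset.card_pair hpq, Finset.card_pair hpr, Finset.card_pair hqr]
  by_cases hS : S.card + 2 = Fintype.card V
  · have h1 : SpansFrom s t S {p, q} → _ := fun h => h.pair_xor hS r
    have h2 : SpansFrom s t S {p, r} → _ := fun h => h.pair_xor hS q
    have h3 : SpansFrom s t S {q, r} → _ := fun h => h.pair_xor hS p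
    rw [Finset.pair_comm r q] at h2
    rw [Finset.pair_comm r p, Finset.pair_comm q p] at h3
    have h4 : ∀ c : ZMod 2, c + c = 0 := CharTwo.add_self_eq_zero
    by_cases ha : SpansFrom s t S {p, q} <;> by_cases hb : SpansFrom s t S {p, r} <;>
      by_cases hc : SpansFrom s t S {q, r} <;> simp_all
  · simp [hS]

section Involution

variable {s t : E → V} {τ : E → E} {σ : V → V} (hτ : Function.Involutive τ)
  (hσ : Function.Involutive σ)
  (hst : ∀ e, (s (τ e) = σ (s e) ∧ t (τ e) = σ (t e)) ∨ (s (τ e) = σ (t e) ∧ t (τ e) = σ (s e)))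

include hst in
omit [Fintype V] [Fintype E] in
lemma SpansFrom.image {S : Finset E} {I : Finset V} (hσ : Function.Involutive σ)
    (h : SpansFrom s t S I) : SpansFrom s t (S.image τ) (I.image σ) := by
  intro φ h1 h2
  have h3 := h (φ ∘ σ) (fun e he => by
    have h4 := h1 (τ e) (Finset.mem_image_of_mem τ he)
    rcases hst e with ⟨h5, h6⟩ | ⟨h5, h6⟩
    · rw [h5, h6] at h4; exact h4
    · rw [h5, h6] at h4; exact h4.symm) (fun x hx => h2 _ (Finset.mem_image_of_mem σ hx))
  funext x
  have h4 := congrFun h3 (σ x)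
  simpa [hσ x] using h4

include hτ hσ hst in
lemma image_mem_rootedForests {S : Finset E} {I : Finset V} (h : S ∈ rootedForests s t I) :
    S.image τ ∈ rootedForests s t (I.image σ) := by
  simp only [rootedForests, Finset.mem_filter, Finset.mem_univ, true_and] at h ⊢
  rw [Finset.card_image_of_injective _ hτ.injective, Finset.card_image_of_injective _ hσ.injective]
  exact ⟨h.1, h.2.image hst hσ⟩

omit [Fintype E] in
include hτ in
lemma image_image_of_involutive (S : Finset E) : (S.image τ).image τ = S := by
  rw [Finset.image_image, hτ.comp_self, Finset.image_id]

include hτ in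
lemma prod_compl_image (S : Finset E) (y : E → ZMod 2) :
    ∏ e ∈ (S.image τ)ᶜ, y e = ∏ e ∈ Sᶜ, y (τ e) := by
  refine (Finset.prod_nbij τ (fun e he => ?_) hτ.injective.injOn (fun e he => ?_)
    fun _ _ => rfl).symm
  · simpa [hτ.injective.eq_iff] using he
  · refine ⟨τ e, ?_, hτ e⟩
    have h : ∀ x ∈ S, τ x ≠ e := by simpa using he
    have : τ e ∉ S := fun hmem => h _ hmem (hτ e)
    simpa using this

include hτ hσ hst in
lemma coWeight_comp (I : Finset V) (y : E → ZMod 2) :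
    coWeight (rootedForests s t I) (y ∘ τ) = coWeight (rootedForests s t (I.image σ)) y := by
  refine Finset.sum_nbij' (Finset.image τ) (Finset.image τ)
    (fun S hS => image_mem_rootedForests hτ hσ hst hS) (fun S hS => ?_)
    (fun S _ => image_image_of_involutive hτ S) (fun S _ => image_image_of_involutive hτ S)
    (fun S _ => (prod_compl_image hτ S y).symm)
  have := image_mem_rootedForests hτ hσ hst hS
  rwa [image_image_of_involutive hσ] at this

include hτ in
/-- On invariant points, only the invariant members of an invariant family matter. -/
lemma coWeight_eq_coWeight_invariant {F : Finset (Finset E)}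
    (hF : ∀ S ∈ F, S.image τ ∈ F) {y : E → ZMod 2} (hy : y ∘ τ = y) :
    coWeight F y = coWeight (F.filter fun S => S.image τ = S) y := by
  rw [coWeight, ← Finset.sum_filter_add_sum_filter_not F (fun S => S.image τ = S), coWeight]
  refine add_eq_left.mpr (Finset.sum_involution (fun S _ => S.image τ) ?_ ?_ ?_ ?_)
  · intro S _
    rw [prod_compl_image hτ]
    have : ∀ e, y (τ e) = y e := congrFun hy
    simp [this, CharTwo.add_self_eq_zero]
  · intro S hS _
    exact (Finset.mem_filter.mp hS).2
  · intro S hS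
    rw [Finset.mem_filter] at hS ⊢
    refine ⟨hF S hS.1, fun h => hS.2 ?_⟩
    rw [image_image_of_involutive hτ] at h
    exact h.symm
  · intro S _
    exact image_image_of_involutive hτ S

include hτ in
/-- A function on invariant points that does not depend on the coordinates in one orbit has
vanishing sum mod 2. -/
lemma sum_invariant_eq_zero (h : (E → ZMod 2) → ZMod 2) (e₀ : E)
    (hh : ∀ y y' : E → ZMod 2, (∀ e, e ≠ e₀ → e ≠ τ e₀ → y e = y' e) → h y = h y') :
    ∑ y : E → ZMod 2 with y ∘ τ = y, h y = 0 := by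
  set d : E → ZMod 2 := fun e => if e = e₀ ∨ e = τ e₀ then 1 else 0 with hd
  have hdτ : ∀ e, d (τ e) = d e := by
    intro e
    have : (τ e = e₀ ∨ τ e = τ e₀) ↔ (e = e₀ ∨ e = τ e₀) := by
      rw [hτ.injective.eq_iff, hτ.eq_iff, or_comm]
    simp only [hd, this]
  refine Finset.sum_involution (fun y _ => y + d) ?_ ?_ ?_ ?_
  · intro y _
    rw [hh (y + d) y fun e h1 h2 => by simp [hd, h1, h2], CharTwo.add_self_eq_zero]
  · intro y _ _ heq
    have := congrFun heq e₀
    simp [hd] at this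
  · intro y hy
    simp only [Finset.mem_filter, Finset.mem_univ, true_and] at hy ⊢
    funext e
    simp only [Function.comp_apply, Pi.add_apply, hdτ]
    rw [← congrFun hy e]
    rfl
  · intro y _
    funext e
    simp [add_assoc, CharTwo.add_self_eq_zero]

include hτ in
lemma sum_invariant_coWeight_mul_eq_zero {F F' : Finset (Finset E)}
    (hF : ∀ S ∈ F, S.image τ ∈ F) (hF' : ∀ S ∈ F', S.image τ ∈ F')
    (hmeet : ∀ S ∈ F, ∀ S' ∈ F', S.image τ = S → S'.image τ = S' → (S ∩ S').Nonempty) :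
    ∑ y : E → ZMod 2 with y ∘ τ = y, coWeight F y * coWeight F' y = 0 := by
  have h1 : ∑ y : E → ZMod 2 with y ∘ τ = y, coWeight F y * coWeight F' y =
      ∑ y : E → ZMod 2 with y ∘ τ = y, ∑ S ∈ F with S.image τ = S, ∑ S' ∈ F' with S'.image τ = S',
        (∏ e ∈ Sᶜ, y e) * ∏ e ∈ S'ᶜ, y e := by
    refine Finset.sum_congr rfl fun y hy => ?_
    have hy' := (Finset.mem_filter.mp hy).2
    rw [coWeight_eq_coWeight_invariant hτ hF hy', coWeight_eq_coWeight_invariant hτ hF' hy',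
      coWeight, coWeight, Finset.sum_mul_sum]
  rw [h1, Finset.sum_comm]
  refine Finset.sum_eq_zero fun S hS => ?_
  rw [Finset.sum_comm]
  refine Finset.sum_eq_zero fun S' hS' => ?_
  rw [Finset.mem_filter] at hS hS'
  obtain ⟨e₀, he₀⟩ := hmeet S hS.1 S' hS'.1 hS.2 hS'.2
  rw [Finset.mem_inter] at he₀
  have hτe : ∀ U : Finset E, U.image τ = U → e₀ ∈ U → ∀ e ∈ Uᶜ, e ≠ e₀ ∧ e ≠ τ e₀ := by
    intro U hU h0 e he
    rw [Finset.mem_compl] at he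
    refine ⟨fun h => he (h ▸ h0), fun h => he ?_⟩
    rw [h, ← hU]
    exact Finset.mem_image_of_mem τ h0
  refine sum_invariant_eq_zero hτ _ e₀ fun y y' hyy' => ?_
  congr 1
  · exact Finset.prod_congr rfl fun e he =>
      hyy' e (hτe S hS.2 he₀.1 e he).1 (hτe S hS.2 he₀.1 e he).2
  · exact Finset.prod_congr rfl fun e he =>
      hyy' e (hτe S' hS'.2 he₀.2 e he).1 (hτe S' hS'.2 he₀.2 e he).2

include hτ in
lemma sum_eq_sum_invariant (c : (E → ZMod 2) → ZMod 2) (hc : ∀ y, c (y ∘ τ) = c y) :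
    ∑ y, c y = ∑ y : E → ZMod 2 with y ∘ τ = y, c y := by
  rw [← Finset.sum_filter_add_sum_filter_not Finset.univ (fun y : E → ZMod 2 => y ∘ τ = y)]
  have hinv : ∀ y : E → ZMod 2, (y ∘ τ) ∘ τ = y := fun y => by
    rw [Function.comp_assoc, hτ.comp_self, Function.comp_id]
  refine add_eq_left.mpr (Finset.sum_involution (fun y _ => y ∘ τ) ?_ ?_ ?_ ?_)
  · intro y _
    rw [hc, CharTwo.add_self_eq_zero]
  · intro y hy _
    exact (Finset.mem_filter.mp hy).2
  · intro y hy
    simp only [Finset.mem_filter, Finset.mem_univ, true_and, hinv] at hy ⊢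
    exact fun h => hy h.symm
  · intro y _
    exact hinv y

end Involution

/-- The forest expansion of the Kirchhoff polynomial at a vertex of degree three with neighbours
`a 0`, `a 1`, `a 2`: the variables `α` belong to the edges at that vertex. -/
noncomputable def starPoly (s t : E → V) (a : Fin 3 → V) (α : Fin 3 → ZMod 2)
    (y : E → ZMod 2) : ZMod 2 :=
  ∑ R : Finset (Fin 3), (∏ i ∈ Rᶜ, α i) * coWeight (rootedForests s t (R.image a)) y

lemma sum_finset_fin_three {M : Type*} [AddCommMonoid M] (f : Finset (Fin 3) → M) :
    ∑ R, f R = f ∅ + (f {0} + (f {1} + (f {2} + (f {0, 1} + (f {0, 2} + (f {1, 2} +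
      f {0, 1, 2})))))) := by
  have h : (Finset.univ : Finset (Finset (Fin 3))) =
      {∅, {0}, {1}, {2}, {0, 1}, {0, 2}, {1, 2}, {0, 1, 2}} := by decide
  rw [h]
  repeat rw [Finset.sum_insert (by decide)]
  rw [Finset.sum_singleton]

/-- A decidable form of the polynomial `starPoly` in the three star variables. -/
def starForm (f g₀₁ g₀₂ g₁₂ c : ZMod 2) (α : Fin 3 → ZMod 2) : ZMod 2 :=
  f * (α 1 * α 2 + α 0 * α 2 + α 0 * α 1) + (g₀₁ * α 2 + g₀₂ * α 1 + g₁₂ * α 0) + c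

lemma card_starForm_eq_zero (f g₀₁ g₀₂ g₁₂ c : ZMod 2) (h : g₀₁ + g₀₂ + g₁₂ = 0) :
    Fintype.card {α // starForm f g₀₁ g₀₂ g₁₂ c α = 0} % 4 = 0 ∧
      ((Fintype.card {α // starForm f g₀₁ g₀₂ g₁₂ c α = 0} / 4 : ℕ) : ZMod 2) =
        1 + (1 + f) * (1 + g₀₁) * (1 + g₀₂) * (1 + g₁₂) := by
  revert f g₀₁ g₀₂ g₁₂ c
  simp only [starForm]
  decide +kernel

lemma starPoly_eq_starForm [Nonempty V] (s t : E → V) (a : Fin 3 → V) (α : Fin 3 → ZMod 2)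
    (y : E → ZMod 2) :
    starPoly s t a α y = starForm (coWeight (rootedForests s t {a 2}) y)
      (coWeight (rootedForests s t {a 0, a 1}) y) (coWeight (rootedForests s t {a 0, a 2}) y)
      (coWeight (rootedForests s t {a 1, a 2}) y)
      (coWeight (rootedForests s t {a 0, a 1, a 2}) y) α := by
  have e0 : ({0}ᶜ : Finset (Fin 3)) = {1, 2} := by decide
  have e1 : ({1}ᶜ : Finset (Fin 3)) = {0, 2} := by decide
  have e2 : ({2}ᶜ : Finset (Fin 3)) = {0, 1} := by decide
  have e01 : ({0, 1}ᶜ : Finset (Fin 3)) = {2} := by decide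
  have e02 : ({0, 2}ᶜ : Finset (Fin 3)) = {1} := by decide
  have e12 : ({1, 2}ᶜ : Finset (Fin 3)) = {0} := by decide
  have e012 : ({0, 1, 2}ᶜ : Finset (Fin 3)) = ∅ := by decide
  rw [starPoly, sum_finset_fin_three, starForm, e0, e1, e2, e01, e02, e12, e012]
  simp only [Finset.image_empty, Finset.image_singleton, Finset.image_insert,
    rootedForests_empty, rootedForests_singleton s t (a 0) (a 2),
    rootedForests_singleton s t (a 1) (a 2), Finset.prod_singleton, Finset.prod_empty]
  rw [Finset.prod_pair (by decide), Finset.prod_pair (by decide), Finset.prod_pair (by decide)]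
  simp only [coWeight, Finset.sum_empty]
  ring

/-- The parity of a quarter of the number of zeros of `starPoly` in the star variables. -/
noncomputable def starParity (s t : E → V) (a : Fin 3 → V) (y : E → ZMod 2) : ZMod 2 :=
  1 + (1 + coWeight (rootedForests s t {a 2}) y) *
    (1 + coWeight (rootedForests s t {a 0, a 1}) y) *
    (1 + coWeight (rootedForests s t {a 0, a 2}) y) *
    (1 + coWeight (rootedForests s t {a 1, a 2}) y)

lemma card_starPoly_eq_zero [Nonempty V] (s t : E → V) {a : Fin 3 → V}
    (ha : Function.Injective a) (y : E → ZMod 2) :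
    ∃ u : ℕ, Nat.card {α // starPoly s t a α y = 0} = 4 * u ∧ (u : ZMod 2) = starParity s t a y := by
  have h := coWeight_pair_add s t y (ha.ne (by decide : (0 : Fin 3) ≠ 1))
    (ha.ne (by decide : (0 : Fin 3) ≠ 2)) (ha.ne (by decide : (1 : Fin 3) ≠ 2))
  obtain ⟨h1, h2⟩ := card_starForm_eq_zero (coWeight (rootedForests s t {a 2}) y) _ _ _
    (coWeight (rootedForests s t {a 0, a 1, a 2}) y) h
  refine ⟨_, ?_, h2⟩
  simp only [starPoly_eq_starForm, Nat.card_eq_fintype_card]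
  omega

lemma eight_dvd_card_of_sum_starParity [Nonempty V] (s t : E → V) {a : Fin 3 → V}
    (ha : Function.Injective a) (h : ∑ y, starParity s t a y = 0) :
    8 ∣ Nat.card {p : (Fin 3 → ZMod 2) × (E → ZMod 2) // starPoly s t a p.1 p.2 = 0} := by
  choose u hu hu' using card_starPoly_eq_zero s t ha
  have h1 : Nat.card {p : (Fin 3 → ZMod 2) × (E → ZMod 2) // starPoly s t a p.1 p.2 = 0} =
      4 * ∑ y, u y := by
    rw [Finset.mul_sum, ← Finset.sum_congr rfl fun y _ => hu y, ← Nat.card_sigma]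
    exact Nat.card_congr
      ⟨fun p => ⟨p.1.2, p.1.1, p.2⟩, fun q => ⟨(q.2.1, q.1), q.2.2⟩, fun _ => rfl, fun _ => rfl⟩
  have h2 : 2 ∣ ∑ y, u y := by
    rw [← ZMod.natCast_eq_zero_iff]
    push_cast
    rw [← h]
    exact Finset.sum_congr rfl fun y _ => hu' y
  rw [h1]
  exact mul_dvd_mul_left 4 h2

section Involution

variable {s t : E → V} {τ : E → E} {σ : V → V} (hτ : Function.Involutive τ)
  (hσ : Function.Involutive σ)
  (hst : ∀ e, (s (τ e) = σ (s e) ∧ t (τ e) = σ (t e)) ∨ (s (τ e) = σ (t e) ∧ t (τ e) = σ (s e)))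
  {a : Fin 3 → V} (ha : Function.Injective a) (h0 : σ (a 0) = a 1) (h1 : σ (a 1) = a 0)
  (h2 : σ (a 2) = a 2)

include hτ hσ hst h0 h1 h2 in
lemma starParity_comp (y : E → ZMod 2) : starParity s t a (y ∘ τ) = starParity s t a y := by
  simp only [starParity, coWeight_comp hτ hσ hst, Finset.image_singleton, Finset.image_insert,
    h0, h1, h2, Finset.pair_comm (a 1) (a 0)]
  ring

include hτ hσ hst ha h0 h2 in
lemma starParity_eq_of_invariant {y : E → ZMod 2} (hy : y ∘ τ = y) :
    starParity s t a y = coWeight (rootedForests s t {a 2}) y +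
      coWeight (rootedForests s t {a 0, a 2} ∩ rootedForests s t {a 1, a 2}) y +
      coWeight (rootedForests s t {a 2}) y *
        coWeight (rootedForests s t {a 0, a 2} ∩ rootedForests s t {a 1, a 2}) y := by
  have hadd := coWeight_pair_add s t y (ha.ne (by decide : (0 : Fin 3) ≠ 1))
    (ha.ne (by decide : (0 : Fin 3) ≠ 2)) (ha.ne (by decide : (1 : Fin 3) ≠ 2))
  have hsymm := coWeight_comp hτ hσ hst {a 0, a 2} y
  rw [hy, Finset.image_insert, Finset.image_singleton, h0, h2] at hsymm
  have hdodgson := coWeight_pair_mul_of_eq_zero s t y (ha.ne (by decide : (0 : Fin 3) ≠ 2))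
    (ha.ne (by decide : (1 : Fin 3) ≠ 2))
  rw [starParity]
  generalize coWeight (rootedForests s t {a 2}) y = f at *
  generalize coWeight (rootedForests s t {a 0, a 2} ∩ rootedForests s t {a 1, a 2}) y = g at *
  generalize coWeight (rootedForests s t {a 0, a 1}) y = g₀₁ at *
  generalize coWeight (rootedForests s t {a 0, a 2}) y = g₀₂ at *
  generalize coWeight (rootedForests s t {a 1, a 2}) y = g₁₂ at *
  revert f g g₀₁ g₀₂ g₁₂
  decide +kernel

include hτ hσ hst ha h0 h1 h2 in
/-- If every invariant spanning tree meets every invariant two-component forest separating `a 0`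
from `a 2`, then the number of zeros of `starPoly` is divisible by eight. -/
theorem eight_dvd_card_starPoly_eq_zero
    (hmeet : ∀ S ∈ rootedForests s t {a 2}, ∀ S' ∈ rootedForests s t {a 0, a 2},
      S.image τ = S → S'.image τ = S' → (S ∩ S').Nonempty) :
    8 ∣ Nat.card {p : (Fin 3 → ZMod 2) × (E → ZMod 2) // starPoly s t a p.1 p.2 = 0} := by
  have : Nonempty V := ⟨a 0⟩
  have hcard : 3 ≤ Fintype.card V := by simpa using Fintype.card_le_of_injective a ha
  refine eight_dvd_card_of_sum_starParity s t ha ?_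
  rw [sum_eq_sum_invariant hτ _ (starParity_comp hτ hσ hst h0 h1 h2),
    Finset.sum_congr rfl fun y hy =>
      starParity_eq_of_invariant hτ hσ hst ha h0 h2 (Finset.mem_filter.mp hy).2,
    Finset.sum_add_distrib, Finset.sum_add_distrib]
  have htree : ∀ S ∈ rootedForests s t {a 2}, S.image τ ∈ rootedForests s t {a 2} := fun S hS => by
    simpa [h2] using image_mem_rootedForests hτ hσ hst hS
  have hforest : ∀ S ∈ rootedForests s t {a 0, a 2} ∩ rootedForests s t {a 1, a 2},
      S.image τ ∈ rootedForests s t {a 0, a 2} ∩ rootedForests s t {a 1, a 2} := fun S hS => by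
    rw [Finset.mem_inter] at hS
    have h3 := image_mem_rootedForests hτ hσ hst hS.1
    have h4 := image_mem_rootedForests hτ hσ hst hS.2
    simp only [Finset.image_insert, Finset.image_singleton, h0, h1, h2] at h3 h4
    exact Finset.mem_inter.mpr ⟨h4, h3⟩
  have huniv : ∀ S ∈ ({Finset.univ} : Finset (Finset E)), S.image τ ∈
      ({Finset.univ} : Finset (Finset E)) := by
    simp [Finset.image_univ_of_surjective hτ.surjective]
  have hone : ∀ y : E → ZMod 2, coWeight {Finset.univ} y = 1 := by simp [coWeight]
  have h3 := sum_invariant_coWeight_mul_eq_zero hτ htree huniv fun S hS S' hS' _ _ => by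
    simp only [rootedForests, Finset.mem_filter, Finset.card_singleton] at hS
    rw [Finset.mem_singleton.mp hS', Finset.inter_univ, ← Finset.card_pos]
    omega
  have h4 := sum_invariant_coWeight_mul_eq_zero hτ hforest huniv fun S hS S' hS' _ _ => by
    simp only [rootedForests, Finset.mem_inter, Finset.mem_filter,
      Finset.card_pair (ha.ne (by decide : (0 : Fin 3) ≠ 2))] at hS
    rw [Finset.mem_singleton.mp hS', Finset.inter_univ, ← Finset.card_pos]
    omega
  have h5 := sum_invariant_coWeight_mul_eq_zero hτ htree hforest fun S hS S' hS' =>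
    hmeet S hS S' (Finset.mem_inter.mp hS').1
  simp only [hone, mul_one] at h3 h4
  rw [h3, h4, h5, add_zero, add_zero]

end Involution

omit [Fintype V] [Fintype E] in
/-- Passing to a quotient of the graph, on which the edges of `S` are represented by `P'` up to
loops, does not increase the number of missing roots. -/
lemma SpansFrom.card_quotient_le {s t : E → V} {S : Finset E} {I : Finset V}
    (h : SpansFrom s t S I) {W P : Type} [Fintype W] [Fintype P] {π : V → W}
    (hπ : Function.Surjective π) (P' : Finset P) (u w : P → W)
    (hP : ∀ e ∈ S, π (s e) = π (t e) ∨ ∃ p ∈ P', (π (s e) = u p ∧ π (t e) = w p) ∨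
      (π (s e) = w p ∧ π (t e) = u p)) :
    Fintype.card W ≤ P'.card + I.card := by
  have h' : SpansFrom u w P' (I.image π) := by
    intro φ h1 h2
    have h3 := h (φ ∘ π) (fun e he => by
      rcases hP e he with h4 | ⟨p, hp, ⟨h4, h5⟩ | ⟨h4, h5⟩⟩
      · simp [h4]
      · simp [h4, h5, h1 p hp]
      · simp [h4, h5, h1 p hp]) (fun x hx => h2 _ (Finset.mem_image_of_mem π hx))
    funext x
    obtain ⟨z, rfl⟩ := hπ x
    exact congrFun h3 z
  exact h'.card_le.trans (Nat.add_le_add_left Finset.card_image_le _)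

lemma rootedForests_inter_nonempty {s t : E → V} {τ : E → E} {W P : Type} [Fintype W] [Fintype P]
    {π : V → W} (hπ : Function.Surjective π) (rep : P → E)
    (hτπ : ∀ e, (π (s (τ e)) = π (s e) ∧ π (t (τ e)) = π (t e)) ∨
      (π (s (τ e)) = π (t e) ∧ π (t (τ e)) = π (s e)))
    (hrep : ∀ e, π (s e) = π (t e) ∨ ∃ p, rep p = e ∨ rep p = τ e)
    (hcard : Fintype.card P + 3 < 2 * Fintype.card W) {S S' : Finset E} {p q r : V}
    (hS : S ∈ rootedForests s t {p}) (hS' : S' ∈ rootedForests s t {q, r})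
    (hSτ : S.image τ = S) (hSτ' : S'.image τ = S') : (S ∩ S').Nonempty := by
  have key : ∀ (U : Finset E) (I : Finset V), U.image τ = U → U ∈ rootedForests s t I →
      Fintype.card W ≤ (Finset.univ.filter fun x => rep x ∈ U).card + I.card := by
    intro U I hU hmem
    refine (Finset.mem_filter.mp hmem).2.2.card_quotient_le hπ _ (fun x => π (s (rep x)))
      (fun x => π (t (rep x))) fun e he => ?_
    refine (hrep e).imp_right ?_
    rintro ⟨x, hx | hx⟩
    · exact ⟨x, by simpa [hx] using he, Or.inl (by simp [hx])⟩
    · refine ⟨x, ?_, ?_⟩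
      · rw [Finset.mem_filter, hx, ← hU]
        exact ⟨Finset.mem_univ _, Finset.mem_image_of_mem τ he⟩
      · simp only [hx]
        rcases hτπ e with ⟨h1, h2⟩ | ⟨h1, h2⟩
        · exact Or.inl ⟨h1.symm, h2.symm⟩
        · exact Or.inr ⟨h2.symm, h1.symm⟩
  have h1 := key S _ hSτ hS
  have h2 := key S' _ hSτ' hS'
  by_contra hne
  rw [Finset.not_nonempty_iff_eq_empty, ← Finset.disjoint_iff_inter_eq_empty] at hne
  have h3 : Disjoint (Finset.univ.filter fun x => rep x ∈ S)
      (Finset.univ.filter fun x => rep x ∈ S') :=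
    Finset.disjoint_filter.mpr fun x _ hx hx' => Finset.disjoint_left.mp hne hx hx'
  have h4 := (Finset.card_union_of_disjoint h3).symm.le.trans (Finset.card_le_univ _)
  have h5 := Finset.card_le_two (a := q) (b := r)
  rw [Finset.card_singleton] at h1
  omega

section Kirchhoff

variable {Vg : Type} {G : SimpleGraph Vg} {ι : V ≃ Vg} {ε : E ≃ G.edgeSet} {s t : E → V}
  (hε : ∀ e, (ε e : Sym2 Vg) = s(ι (s e), ι (t e)))

include hε in
omit [Fintype V] [Fintype E] in
lemma connected_fromEdgeSet_iff_spansFrom (S : Finset E) (r : V) :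
    (SimpleGraph.fromEdgeSet ((fun e => (ε e : Sym2 Vg)) '' S)).Connected ↔
      SpansFrom s t S {r} := by
  have hne : ∀ e, ι (s e) ≠ ι (t e) := fun e => by
    have h := (ε e).2
    rw [hε, SimpleGraph.mem_edgeSet] at h
    exact h.ne
  set H := SimpleGraph.fromEdgeSet ((fun e => (ε e : Sym2 Vg)) '' S) with hH
  have hadj : ∀ e ∈ S, H.Adj (ι (s e)) (ι (t e)) := fun e he => by
    rw [hH, SimpleGraph.fromEdgeSet_adj]
    exact ⟨⟨e, he, hε e⟩, hne e⟩
  constructor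
  · intro h φ h1 h2
    have h3 : ∀ x y, H.Adj x y → φ (ι.symm x) = φ (ι.symm y) := by
      intro x y hxy
      rw [hH, SimpleGraph.fromEdgeSet_adj] at hxy
      obtain ⟨⟨e, he, hxy⟩, -⟩ := hxy
      simp only [hε, Sym2.eq_iff] at hxy
      rcases hxy with ⟨rfl, rfl⟩ | ⟨rfl, rfl⟩ <;> simp [h1 e he]
    have h4 : ∀ x y, H.Walk x y → φ (ι.symm x) = φ (ι.symm y) := by
      intro x y p
      induction p with
      | nil => rfl
      | cons hxy _ ih => exact (h3 _ _ hxy).trans ih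
    funext x
    obtain ⟨p⟩ := h.preconnected (ι x) (ι r)
    simpa [h2 r (by simp)] using h4 _ _ p
  · intro h
    rw [SimpleGraph.connected_iff_exists_forall_reachable]
    refine ⟨ι r, fun x => ?_⟩
    have h1 := h (fun z => if H.Reachable (ι r) (ι z) then 0 else 1) (fun e he => by
      have : H.Reachable (ι r) (ι (s e)) ↔ H.Reachable (ι r) (ι (t e)) :=
        ⟨fun h => h.trans (hadj e he).reachable, fun h => h.trans (hadj e he).reachable.symm⟩
      simp only [this]) (by simp)
    have h2 := congrFun h1 (ι.symm x)
    simpa using h2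

include hε in
lemma isSpanningTree_iff_mem_rootedForests (S : Finset E) (r : V) :
    IsSpanningTree G ((fun e => (ε e : Sym2 Vg)) '' S) ↔ S ∈ rootedForests s t {r} := by
  have : Fintype Vg := Fintype.ofEquiv V ι
  have hsub : ((fun e => (ε e : Sym2 Vg)) '' S) ⊆ G.edgeSet := by
    rintro _ ⟨e, -, rfl⟩
    exact (ε e).2
  have hcard : Nat.card (SimpleGraph.fromEdgeSet ((fun e => (ε e : Sym2 Vg)) '' S)).edgeSet =
      S.card := by
    have h1 : (SimpleGraph.fromEdgeSet ((fun e => (ε e : Sym2 Vg)) '' S)).edgeSet =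
        (fun e => (ε e : Sym2 Vg)) '' S := by
      rw [SimpleGraph.edgeSet_fromEdgeSet]
      exact sdiff_eq_left.mpr (Set.disjoint_left.mpr fun e he =>
        SimpleGraph.not_isDiag_of_mem_edgeSet G (hsub he))
    rw [h1, Nat.card_image_of_injective (f := fun e => (ε e : Sym2 Vg))
      (Subtype.val_injective.comp ε.injective)]
    simp
  have htree := SimpleGraph.isTree_iff_connected_and_card
    (G := SimpleGraph.fromEdgeSet ((fun e => (ε e : Sym2 Vg)) '' S))
  rw [SimpleGraph.isTree_iff, hcard, connected_fromEdgeSet_iff_spansFrom hε S r,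
    ← Nat.card_congr ι, Nat.card_eq_fintype_card] at htree
  rw [IsSpanningTree, connected_fromEdgeSet_iff_spansFrom hε S r, htree, rootedForests]
  simp [hsub, and_comm]

include hε in
lemma eval_kirchhoff [Fintype Vg] (r : V) (x : G.edgeSet → ZMod 2) :
    MvPolynomial.eval x (MvPolynomial.map (Int.castRingHom (ZMod 2)) (kirchhoff G)) =
      coWeight (rootedForests s t {r}) (x ∘ ε) := by
  simp only [kirchhoff, map_sum, map_prod]
  symm
  have hinj : Function.Injective fun e => (ε e : Sym2 Vg) :=
    Subtype.val_injective.comp ε.injective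
  refine Finset.sum_nbij (fun S => S.image fun e => (ε e : Sym2 Vg)) ?_ ?_ ?_ ?_
  · intro S hS
    rw [Finset.mem_filter, Finset.mem_powerset, Finset.coe_image,
      isSpanningTree_iff_mem_rootedForests hε S r]
    refine ⟨?_, hS⟩
    intro e he
    obtain ⟨e, -, rfl⟩ := Finset.mem_image.mp he
    simp
  · exact (Finset.image_injective hinj).injOn
  · intro T hT
    rw [Finset.mem_coe, Finset.mem_filter, Finset.mem_powerset] at hT
    have himage : (Finset.univ.filter fun e => (ε e : Sym2 Vg) ∈ T).image
        (fun e => (ε e : Sym2 Vg)) = T := by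
      ext e
      simp only [Finset.mem_image, Finset.mem_filter, Finset.mem_univ, true_and]
      refine ⟨?_, fun he => ?_⟩
      · rintro ⟨e, he, rfl⟩
        exact he
      · exact ⟨ε.symm ⟨e, SimpleGraph.mem_edgeFinset.mp (hT.1 he)⟩, by simpa using he, by simp⟩
    refine ⟨_, ?_, himage⟩
    rw [Finset.mem_coe, ← isSpanningTree_iff_mem_rootedForests hε _ r, ← Finset.coe_image, himage]
    exact hT.2
  · intro S _
    rw [← Equiv.prod_comp ε]
    simp only [hinj.mem_finset_image, apply_ite (MvPolynomial.map (Int.castRingHom (ZMod 2))),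
      apply_ite (MvPolynomial.eval x), map_one, MvPolynomial.map_X, MvPolynomial.eval_X]
    rw [Finset.prod_ite, Finset.prod_const_one, one_mul]
    refine Finset.prod_congr ?_ fun _ _ => rfl
    ext e
    simp

include hε in
lemma zeroCount_two_eq [Fintype Vg] (r : V) :
    zeroCount G 2 = Nat.card {y : E → ZMod 2 // coWeight (rootedForests s t {r}) y = 0} := by
  simp only [zeroCount, eval_kirchhoff hε r]
  exact Nat.card_congr ((ε.symm.arrowCongr (Equiv.refl (ZMod 2))).subtypeEquiv fun x => Iff.rfl)

end Kirchhoff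

/-- The source map after attaching a new vertex `none`, joined to the vertices `a i`. -/
def coneSource (s : E → V) : Fin 3 ⊕ E → Option V :=
  Sum.elim (fun _ => none) (some ∘ s)

/-- The target map after attaching a new vertex `none`, joined to the vertices `a i`. -/
def coneTarget (t : E → V) (a : Fin 3 → V) : Fin 3 ⊕ E → Option V :=
  Sum.elim (some ∘ a) (some ∘ t)

lemma disjSum_mem_rootedForests_cone (s t : E → V) {a : Fin 3 → V} (ha : Function.Injective a)
    (R : Finset (Fin 3)) (S : Finset E) :
    R.disjSum S ∈ rootedForests (coneSource s) (coneTarget t a) {none} ↔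
      S ∈ rootedForests s t (R.image a) := by
  have hspan : SpansFrom (coneSource s) (coneTarget t a) (R.disjSum S) {none} ↔
      SpansFrom s t S (R.image a) := by
    constructor
    · intro h φ h1 h2
      have h3 := h (fun x => x.elim 0 φ) (fun e he => by
        rcases Finset.mem_disjSum.mp he with ⟨i, hi, rfl⟩ | ⟨e, he, rfl⟩
        · exact (h2 _ (Finset.mem_image_of_mem a hi)).symm
        · exact h1 e (Finset.inr_mem_disjSum.mp he)) (by simp)
      funext x
      exact congrFun h3 (some x)
    · intro h φ h1 h2
      have h0 : φ none = 0 := h2 none (by simp)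
      have h3 := h (φ ∘ some) (fun e he => h1 (Sum.inr e) (by simpa using he)) (fun x hx => by
        obtain ⟨i, hi, rfl⟩ := Finset.mem_image.mp hx
        exact (h1 (Sum.inl i) (by simpa using hi)).symm.trans h0)
      funext x
      cases x with
      | none => exact h0
      | some x => exact congrFun h3 x
  simp only [rootedForests, Finset.mem_filter, Finset.mem_univ, true_and, hspan,
    Finset.card_disjSum, Finset.card_singleton, Fintype.card_option,
    Finset.card_image_of_injective _ ha]
  refine and_congr_left fun _ => ?_
  omega

lemma coWeight_cone (s t : E → V) {a : Fin 3 → V} (ha : Function.Injective a)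
    (α : Fin 3 → ZMod 2) (y : E → ZMod 2) :
    coWeight (rootedForests (coneSource s) (coneTarget t a) {none}) (Sum.elim α y) =
      starPoly s t a α y := by
  simp only [starPoly, coWeight_eq_sum_ite, Finset.mul_sum]
  rw [← Fintype.sum_prod_type']
  symm
  refine Fintype.sum_equiv (Finset.sumEquiv (α := Fin 3) (β := E)).symm.toEquiv _ _ ?_
  rintro ⟨R, S⟩
  have hcompl : ∀ [DecidableEq (Fin 3 ⊕ E)], (R.disjSum S)ᶜ = Rᶜ.disjSum Sᶜ := by
    intro _
    ext e
    cases e <;> simp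
  have hsum : (Finset.sumEquiv (α := Fin 3) (β := E)).symm.toEquiv (R, S) = R.disjSum S := rfl
  rw [hsum, @hcompl fun _ _ => Classical.propDecidable _, Finset.prod_disjSum]
  simp only [disjSum_mem_rootedForests_cone s t ha, Sum.elim_inl, Sum.elim_inr, mul_ite, mul_zero]

lemma zeroCount_cone {Vg : Type} [Fintype Vg] {G : SimpleGraph Vg} {ι : Option V ≃ Vg}
    {ε : Fin 3 ⊕ E ≃ G.edgeSet} {s t : E → V} {a : Fin 3 → V} (ha : Function.Injective a)
    (hε : ∀ e, (ε e : Sym2 Vg) = s(ι (coneSource s e), ι (coneTarget t a e))) :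
    zeroCount G 2 =
      Nat.card {p : (Fin 3 → ZMod 2) × (E → ZMod 2) // starPoly s t a p.1 p.2 = 0} := by
  rw [zeroCount_two_eq hε none]
  simp only [← coWeight_cone s t ha]
  refine Nat.card_congr ((Equiv.sumArrowEquivProdArrow _ _ _).subtypeEquiv fun y => ?_)
  simp [Equiv.sumArrowEquivProdArrow]

end RootedForests

section Torus

open Finset

/-- The unit step in the first (`true`) or second (`false`) direction of a toroidal grid. -/
def torusStep (k N : ℕ) (b : Bool) : ZMod k × ZMod N :=
  if b then (1, 0) else (0, 1)

/-- The position differs from the two removed positions `(0, 0)` and `(1, 0)`. -/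
def IsKept {k N : ℕ} (p : ZMod k × ZMod N) : Prop :=
  ¬ (p.2 = 0 ∧ (p.1 = 0 ∨ p.1 = 1))

/-- The vertices of the toroidal grid with two adjacent vertices removed. -/
abbrev KeptVertex (k N : ℕ) : Type :=
  {p : ZMod k × ZMod N // IsKept p}

/-- The edges of the toroidal grid with two adjacent vertices removed, given by direction and
starting point. -/
abbrev KeptEdge (k N : ℕ) : Type :=
  {d : Bool × (ZMod k × ZMod N) // IsKept d.2 ∧ IsKept (d.2 + torusStep k N d.1)}

variable {k N : ℕ}

/-- The starting point of an edge. -/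
def keptSource (d : KeptEdge k N) : KeptVertex k N :=
  ⟨d.1.2, d.2.1⟩

/-- The end point of an edge. -/
def keptTarget (d : KeptEdge k N) : KeptVertex k N :=
  ⟨d.1.2 + torusStep k N d.1.1, d.2.2⟩

/-- The reflection of the toroidal grid in the first axis. -/
def torusReflect (p : ZMod k × ZMod N) : ZMod k × ZMod N :=
  (p.1, -p.2)

lemma torusReflect_torusReflect (p : ZMod k × ZMod N) : torusReflect (torusReflect p) = p := by
  simp [torusReflect]

lemma isKept_torusReflect {p : ZMod k × ZMod N} : IsKept (torusReflect p) ↔ IsKept p := by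
  simp [IsKept, torusReflect]

lemma torusReflect_add_true (p : ZMod k × ZMod N) :
    torusReflect p + torusStep k N true = torusReflect (p + torusStep k N true) := by
  simp [torusReflect, torusStep]

lemma torusReflect_add_false (p : ZMod k × ZMod N) :
    torusReflect (p + torusStep k N false) + torusStep k N false = torusReflect p := by
  simp [torusReflect, torusStep]

/-- The reflection on vertices. -/
def keptReflect (p : KeptVertex k N) : KeptVertex k N :=
  ⟨torusReflect p.1, isKept_torusReflect.mpr p.2⟩

/-- The reflection on edges; it reverses the edges in the second direction. -/
def edgeReflect : KeptEdge k N → KeptEdge k N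
  | ⟨(true, p), h⟩ => ⟨(true, torusReflect p), isKept_torusReflect.mpr h.1, by
      rw [torusReflect_add_true]
      exact isKept_torusReflect.mpr h.2⟩
  | ⟨(false, p), h⟩ => ⟨(false, torusReflect (p + torusStep k N false)),
      isKept_torusReflect.mpr h.2, by
      rw [torusReflect_add_false]
      exact isKept_torusReflect.mpr h.1⟩

lemma keptReflect_involutive : Function.Involutive (keptReflect (k := k) (N := N)) := fun p =>
  Subtype.ext (torusReflect_torusReflect p.1)

lemma edgeReflect_involutive : Function.Involutive (edgeReflect (k := k) (N := N)) := by
  rintro ⟨⟨_ | _, p⟩, h⟩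
  · simp only [edgeReflect, torusReflect_add_false, torusReflect_torusReflect]
  · simp only [edgeReflect, torusReflect_torusReflect]

lemma ends_edgeReflect (d : KeptEdge k N) :
    (keptSource (edgeReflect d) = keptReflect (keptSource d) ∧
      keptTarget (edgeReflect d) = keptReflect (keptTarget d)) ∨
    (keptSource (edgeReflect d) = keptReflect (keptTarget d) ∧
      keptTarget (edgeReflect d) = keptReflect (keptSource d)) := by
  obtain ⟨⟨_ | _, p⟩, h⟩ := d
  · exact Or.inr ⟨rfl, Subtype.ext (torusReflect_add_false p)⟩
  · exact Or.inl ⟨rfl, Subtype.ext (torusReflect_add_true p)⟩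

/-- The row of the folded grid containing a second coordinate. -/
def foldRow [NeZero N] (y : ZMod N) : Fin (N / 2 + 1) :=
  ⟨y.valMinAbs.natAbs, Nat.lt_succ_of_le (ZMod.natAbs_valMinAbs_le y)⟩

lemma foldRow_neg [NeZero N] (y : ZMod N) : foldRow (-y) = foldRow y := by
  simp [foldRow, ZMod.natAbs_valMinAbs_neg]

lemma foldRow_val_eq_zero [NeZero N] {y : ZMod N} : (foldRow y).val = 0 ↔ y = 0 := by
  simp [foldRow, ZMod.valMinAbs_eq_zero]

lemma foldRow_natCast [NeZero N] (r : Fin (N / 2 + 1)) : foldRow ((r.val : ℕ) : ZMod N) = r := by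
  refine Fin.ext ?_
  simp only [foldRow]
  rw [ZMod.valMinAbs_natCast_of_le_half (by omega), Int.natAbs_natCast]

lemma natCast_val_eq_zero [NeZero N] {r : ℕ} (hr : r < N) : (r : ZMod N) = 0 ↔ r = 0 := by
  rw [ZMod.natCast_eq_zero_iff]
  exact ⟨fun h => Nat.eq_zero_of_dvd_of_lt h hr, fun h => h ▸ dvd_zero N⟩

/-- `m` rows over `ZMod k`, with the points over `X` removed from the first row. -/
abbrev PuncturedRows (k m : ℕ) (X : Finset (ZMod k)) : Type :=
  {p : ZMod k × Fin m // ¬ (p.2.val = 0 ∧ p.1 ∈ X)}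

lemma card_puncturedRows [NeZero k] {m : ℕ} (hm : 0 < m) (X : Finset (ZMod k)) :
    Fintype.card (PuncturedRows k m X) + X.card = k * m := by
  have h1 : Fintype.card {p : ZMod k × Fin m // p.2.val = 0 ∧ p.1 ∈ X} = X.card := by
    rw [← Fintype.card_coe X]
    refine Fintype.card_congr ⟨fun p => ⟨p.1.1, p.2.2⟩, fun x => ⟨(x.1, ⟨0, hm⟩), rfl, x.2⟩, ?_,
      fun _ => rfl⟩
    rintro ⟨⟨x, r⟩, h⟩
    exact Subtype.ext (Prod.ext rfl (Fin.ext h.1.symm))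
  have h2 := Fintype.card_subtype_compl fun p : ZMod k × Fin m => p.2.val = 0 ∧ p.1 ∈ X
  have h3 := Fintype.card_subtype_le fun p : ZMod k × Fin m => p.2.val = 0 ∧ p.1 ∈ X
  rw [h1] at h2 h3
  rw [h2, Nat.sub_add_cancel h3, Fintype.card_prod, ZMod.card, Fintype.card_fin]

/-- Folding the grid along the axis of the reflection. -/
def foldVertex [NeZero N] (p : KeptVertex k N) : PuncturedRows k (N / 2 + 1) {0, 1} :=
  ⟨(p.1.1, foldRow p.1.2), by
    simp only [foldRow_val_eq_zero, Finset.mem_insert, Finset.mem_singleton]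
    exact p.2⟩

lemma foldVertex_keptReflect [NeZero N] (p : KeptVertex k N) :
    foldVertex (keptReflect p) = foldVertex p :=
  Subtype.ext (Prod.ext rfl (foldRow_neg _))

lemma foldVertex_surjective [NeZero N] :
    Function.Surjective (foldVertex (k := k) (N := N)) := by
  rintro ⟨⟨x, r⟩, h⟩
  have hN := NeZero.pos N
  refine ⟨⟨(x, ((r.val : ℕ) : ZMod N)), ?_⟩, Subtype.ext (Prod.ext rfl (foldRow_natCast r))⟩
  have h1 : ((r.val : ℕ) : ZMod N) = 0 ↔ r.val = 0 := by
    rw [← foldRow_val_eq_zero, foldRow_natCast]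
  simpa [IsKept, h1] using h

/-- Representatives of the edges of the folded grid that are not loops. -/
def foldedEdge [NeZero N] (hN : 3 ≤ N) :
    PuncturedRows k (N / 2 + 1) {-1, 0, 1} ⊕ PuncturedRows k (N / 2) {0, 1} → KeptEdge k N
  | Sum.inl p => ⟨(true, p.1.1, ((p.1.2.val : ℕ) : ZMod N)), by
      have h := p.2
      have h1 : p.1.2.val < N := by omega
      simp only [IsKept, torusStep, if_true, Prod.fst_add, Prod.snd_add, add_zero,
        natCast_val_eq_zero h1, add_eq_right, add_eq_zero_iff_eq_neg]
      simp only [Finset.mem_insert, Finset.mem_singleton] at h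
      tauto⟩
  | Sum.inr p => ⟨(false, p.1.1, ((p.1.2.val : ℕ) : ZMod N)), by
      have h := p.2
      have h1 : p.1.2.val < N := by omega
      have h2 : ((p.1.2.val : ℕ) : ZMod N) + 1 ≠ 0 := by
        rw [← Nat.cast_succ, Ne, natCast_val_eq_zero (by omega)]
        exact Nat.succ_ne_zero _
      simp only [IsKept, torusStep, Prod.fst_add, Prod.snd_add, natCast_val_eq_zero h1]
      simp only [Finset.mem_insert, Finset.mem_singleton] at h
      simp [h2, h]⟩

lemma exists_foldedEdge [NeZero N] (hN : 3 ≤ N) (d : KeptEdge k N) :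
    foldVertex (keptSource d) = foldVertex (keptTarget d) ∨
      ∃ p, foldedEdge hN p = d ∨ foldedEdge hN p = edgeReflect d := by
  obtain ⟨⟨_ | _, x, y⟩, h⟩ := d
  · have hy : ((y.val : ℕ) : ZMod N) = y := ZMod.natCast_zmod_val y
    have hlt := ZMod.val_lt y
    have hz : ((N - 1 - y.val : ℕ) : ZMod N) = -y - 1 := by
      rw [Nat.sub_sub, Nat.cast_sub (by omega)]
      push_cast
      rw [hy, ZMod.natCast_self]
      ring
    have hkept : ∀ r : Fin (N / 2), ∀ z : ZMod N, ((r.val : ℕ) : ZMod N) = z →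
        IsKept (x, z) → ¬ (r.val = 0 ∧ x ∈ ({0, 1} : Finset (ZMod k))) := by
      rintro r z rfl hr ⟨h1, h2⟩
      simp [IsKept, h1] at hr
      simp [hr] at h2
    by_cases h1 : y.val < N / 2
    · exact Or.inr ⟨Sum.inr ⟨(x, ⟨y.val, h1⟩), hkept _ y hy h.1⟩, Or.inl (by
        simp [foldedEdge, hy])⟩
    · by_cases h2 : N - 1 - y.val < N / 2
      · have h3 : IsKept (x, -y - 1) := by
          have := isKept_torusReflect.mpr h.2
          simpa [torusReflect, torusStep, sub_eq_add_neg, add_comm] using this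
        exact Or.inr ⟨Sum.inr ⟨(x, ⟨N - 1 - y.val, h2⟩), hkept _ _ hz h3⟩, Or.inr <|
          Subtype.ext (by
            simp [foldedEdge, edgeReflect, torusReflect, torusStep, hz, sub_eq_add_neg, add_comm])⟩
      · left
        have h3 : N - 1 - y.val = y.val := by omega
        have h4 : y = -y - 1 := by rw [← hz, h3, hy]
        have h5 : foldRow (y + 1) = foldRow y := by
          rw [← foldRow_neg (y + 1), neg_add', ← h4]
        exact Subtype.ext (Prod.ext (by simp [foldVertex, keptSource, keptTarget, torusStep])
          (by simp [foldVertex, keptSource, keptTarget, torusStep, h5]))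
  · right
    have hkept : ∀ r : Fin (N / 2 + 1), ∀ z : ZMod N, ((r.val : ℕ) : ZMod N) = z →
        IsKept (x, z) → IsKept (x + 1, z) →
        ¬ (r.val = 0 ∧ x ∈ ({-1, 0, 1} : Finset (ZMod k))) := by
      rintro r z rfl hr hr' ⟨h1, h2⟩
      simp [IsKept, h1] at hr hr'
      simp [hr] at h2
      simp [h2] at hr'
    have h' : IsKept (x + 1, y) := by simpa [torusStep] using h.2
    by_cases h1 : y.val ≤ N / 2
    · have hy : ((y.val : ℕ) : ZMod N) = y := ZMod.natCast_zmod_val y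
      exact ⟨Sum.inl ⟨(x, ⟨y.val, by omega⟩), hkept _ y hy h.1 h'⟩, Or.inl (by
        simp [foldedEdge, hy])⟩
    · have hlt := ZMod.val_lt y
      have hy : ((N - y.val : ℕ) : ZMod N) = -y := by
        rw [Nat.cast_sub hlt.le, ZMod.natCast_self, zero_sub, ZMod.natCast_zmod_val]
      exact ⟨Sum.inl ⟨(x, ⟨N - y.val, by omega⟩), hkept _ (-y) hy (isKept_torusReflect.mpr h.1)
        (isKept_torusReflect.mpr h')⟩, Or.inr (by
        simp [foldedEdge, edgeReflect, torusReflect, hy])⟩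

lemma card_folded_lt [NeZero k] (hk : 3 ≤ k) [NeZero N] (hN : 3 ≤ N) :
    Fintype.card (PuncturedRows k (N / 2 + 1) {-1, 0, 1} ⊕ PuncturedRows k (N / 2) {0, 1}) + 3 <
      2 * Fintype.card (PuncturedRows k (N / 2 + 1) {0, 1}) := by
  have : Fact (1 < k) := ⟨by omega⟩
  have h01 : (0 : ZMod k) ≠ 1 := zero_ne_one
  have h2 : (-1 : ZMod k) ≠ 0 := neg_ne_zero.mpr one_ne_zero
  have h3 : (-1 : ZMod k) ≠ 1 := by
    have : Fact (2 < k) := ⟨by omega⟩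
    exact ZMod.neg_one_ne_one
  have e1 := card_puncturedRows (k := k) (m := N / 2 + 1) (by omega) {-1, 0, 1}
  have e2 := card_puncturedRows (k := k) (m := N / 2) (by omega) {0, 1}
  have e3 := card_puncturedRows (k := k) (m := N / 2 + 1) (by omega) {0, 1}
  rw [Finset.card_pair h01] at e2 e3
  rw [Finset.card_eq_three.mpr ⟨-1, 0, 1, h2, h3, h01, rfl⟩] at e1
  rw [Fintype.card_sum]
  rw [mul_add, mul_one] at e1 e3
  omega

end Torus

section TorusGraph

variable {k N : ℕ}

lemma ZMod.one_two_neg_one_ne {n : ℕ} (hn : 3 ≤ n) :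
    (1 : ZMod n) ≠ 0 ∧ (2 : ZMod n) ≠ 0 ∧ (-1 : ZMod n) ≠ 1 := by
  have : Fact (1 < n) := ⟨by omega⟩
  have : Fact (2 < n) := ⟨by omega⟩
  refine ⟨one_ne_zero, fun h => ?_, ZMod.neg_one_ne_one⟩
  exact ZMod.neg_one_ne_one (n := n) (neg_eq_of_add_eq_zero_left (by rw [one_add_one_eq_two, h]))

lemma cycleGraph'_adj {n : ℕ} (hn : 3 ≤ n) {i j : ZMod n} :
    (cycleGraph' n).Adj i j ↔ j = i + 1 ∨ i = j + 1 := by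
  have h1 := (ZMod.one_two_neg_one_ne hn).1
  rw [cycleGraph', SimpleGraph.fromRel_adj, sub_eq_iff_eq_add', sub_eq_iff_eq_add', or_comm]
  refine and_iff_right_of_imp ?_
  rintro (rfl | rfl) h
  · simp [h1] at h
  · simp [h1] at h

lemma torus_adj (hk : 3 ≤ k) (hN : 3 ≤ N) {p q : ZMod k × ZMod N} :
    ((cycleGraph' k).boxProd (cycleGraph' N)).Adj p q ↔
      ∃ b, q = p + torusStep k N b ∨ p = q + torusStep k N b := by
  rw [SimpleGraph.boxProd_adj, cycleGraph'_adj hk, cycleGraph'_adj hN]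
  simp only [Bool.exists_bool, torusStep, Prod.ext_iff, if_true, Bool.false_eq_true, if_false,
    Prod.fst_add, Prod.snd_add, add_zero]
  grind

lemma torusStep_injective (hk : 3 ≤ k) : Function.Injective (torusStep k N) := by
  have h1 := (ZMod.one_two_neg_one_ne hk).1
  intro b c h
  cases b <;> cases c <;> simp_all [torusStep]

lemma torusStep_add_ne_zero (hk : 3 ≤ k) (hN : 3 ≤ N) (b c : Bool) :
    torusStep k N b + torusStep k N c ≠ 0 := by
  have h1 := ZMod.one_two_neg_one_ne hk
  have h2 := ZMod.one_two_neg_one_ne hN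
  cases b <;> cases c <;> simp [torusStep, h1, h2, one_add_one_eq_two]

/-- An edge of the torus is determined by its two end points. -/
lemma torus_edge_injective (hk : 3 ≤ k) (hN : 3 ≤ N) :
    Function.Injective fun d : Bool × (ZMod k × ZMod N) => s(d.2, d.2 + torusStep k N d.1) := by
  rintro ⟨b, p⟩ ⟨c, q⟩ h
  rcases Sym2.eq_iff.mp h with ⟨h1, h2⟩ | ⟨h1, h2⟩
  · simp only at h1 h2
    subst h1
    rw [torusStep_injective hk (add_left_cancel h2)]
  · simp only at h1 h2
    rw [h1, add_assoc] at h2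
    exact absurd (add_eq_left.mp h2) (torusStep_add_ne_zero hk hN c b)

lemma isKept_iff {p : ZMod k × ZMod N} : IsKept p ↔ p ≠ 0 ∧ p ≠ (1, 0) := by
  simp only [IsKept, Ne, Prod.ext_iff, Prod.fst_zero, Prod.snd_zero]
  tauto

/-- The neighbours of `(1, 0)` other than `(0, 0)`. -/
def starNeighbor (hk : 3 ≤ k) (hN : 3 ≤ N) : Fin 3 → KeptVertex k N :=
  ![⟨(1, 1), by simp [IsKept, ZMod.one_two_neg_one_ne hN]⟩,
    ⟨(1, -1), by simp [IsKept, ZMod.one_two_neg_one_ne hN]⟩,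
    ⟨(2, 0), by
      have h := ZMod.one_two_neg_one_ne hk
      have h2 : (2 : ZMod k) ≠ 1 := fun h' => h.1 (by
        rwa [← one_add_one_eq_two, add_eq_left] at h')
      simp [IsKept, h, h2]⟩]

lemma starNeighbor_injective (hk : 3 ≤ k) (hN : 3 ≤ N) :
    Function.Injective (starNeighbor hk hN) := by
  have h := ZMod.one_two_neg_one_ne hN
  have h3 := h.2.2.symm
  intro i j hij
  replace hij : (starNeighbor hk hN i).1.2 = (starNeighbor hk hN j).1.2 := by rw [hij]
  fin_cases i <;> fin_cases j <;> simp_all [starNeighbor]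

/-- The position of a vertex relative to the deleted vertex. -/
def conePosition : Option (KeptVertex k N) → ZMod k × ZMod N
  | none => (1, 0)
  | some p => p.1

/-- The direction and starting point of an edge of the torus that avoids the deleted vertex. -/
def coneEdge : Fin 3 ⊕ KeptEdge k N → Bool × (ZMod k × ZMod N)
  | Sum.inl i => ![(false, (1, 0)), (false, (1, -1)), (true, (1, 0))] i
  | Sum.inr d => d.1

lemma coneEdge_ends (hk : 3 ≤ k) (hN : 3 ≤ N) (e : Fin 3 ⊕ KeptEdge k N) :
    s(conePosition (coneSource keptSource e),
      conePosition (coneTarget keptTarget (starNeighbor hk hN) e)) =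
    s((coneEdge e).2, (coneEdge e).2 + torusStep k N (coneEdge e).1) := by
  rcases e with i | d
  · fin_cases i
    · simp [conePosition, coneSource, coneTarget, coneEdge, starNeighbor, torusStep]
    · simp [conePosition, coneSource, coneTarget, coneEdge, starNeighbor, torusStep, Sym2.eq_swap]
    · simp [conePosition, coneSource, coneTarget, coneEdge, starNeighbor, torusStep,
        one_add_one_eq_two]
  · rfl

lemma coneEdge_injective (hN : 3 ≤ N) :
    Function.Injective (coneEdge (k := k) (N := N)) := by
  have h1 := ZMod.one_two_neg_one_ne hN
  rintro (i | d) (j | d') h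
  · congr 1
    fin_cases i <;> fin_cases j <;> simp_all [coneEdge]
  · have h2 := d'.2
    rw [show d'.1 = _ from h.symm] at h2
    fin_cases i <;> simp [coneEdge, IsKept, torusStep] at h2
  · have h2 := d.2
    rw [show d.1 = _ from h] at h2
    fin_cases j <;> simp [coneEdge, IsKept, torusStep] at h2
  · exact congrArg _ (Subtype.ext h)

lemma exists_coneEdge (d : Bool × (ZMod k × ZMod N)) (h : d.2 ≠ 0)
    (h' : d.2 + torusStep k N d.1 ≠ 0) : ∃ e, coneEdge e = d := by
  obtain ⟨b, p⟩ := d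
  by_cases h1 : p = (1, 0)
  · cases b
    · exact ⟨Sum.inl 0, by simp [coneEdge, h1]⟩
    · exact ⟨Sum.inl 2, by simp [coneEdge, h1]⟩
  by_cases h2 : p + torusStep k N b = (1, 0)
  · cases b
    · refine ⟨Sum.inl 1, ?_⟩
      have : p = (1, 0) - torusStep k N false := eq_sub_of_add_eq h2
      simp [coneEdge, this, torusStep]
    · have : p = (1, 0) - torusStep k N true := eq_sub_of_add_eq h2
      exact absurd (by simp [this, torusStep]) h
  exact ⟨Sum.inr ⟨(b, p), isKept_iff.mpr ⟨h, h1⟩, isKept_iff.mpr ⟨h', h2⟩⟩, rfl⟩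

lemma conePosition_injective : Function.Injective (conePosition (k := k) (N := N)) := by
  rintro (_ | p) (_ | q) h
  · rfl
  · exact absurd h.symm (isKept_iff.mp q.2).2
  · exact absurd h (isKept_iff.mp p.2).2
  · exact congrArg some (Subtype.ext h)

lemma conePosition_ne_zero (hk : 3 ≤ k) (x : Option (KeptVertex k N)) : conePosition x ≠ 0 := by
  cases x with
  | none => simp [conePosition, ZMod.one_two_neg_one_ne hk]
  | some p => exact (isKept_iff.mp p.2).1

lemma exists_conePosition {p : ZMod k × ZMod N} (h : p ≠ 0) : ∃ x, conePosition x = p := by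
  by_cases h1 : p = (1, 0)
  · exact ⟨none, h1.symm⟩
  · exact ⟨some ⟨p, isKept_iff.mpr ⟨h, h1⟩⟩, rfl⟩

/-- The vertices of the decompleted torus. -/
noncomputable def coneVertexEquiv (hk : 3 ≤ k) (v : ZMod k × ZMod N) :
    Option (KeptVertex k N) ≃ {w | w ≠ v} :=
  Equiv.ofBijective (fun x => ⟨v + conePosition x, by simp [conePosition_ne_zero hk x]⟩) <| by
    refine ⟨fun x y h => conePosition_injective (add_left_cancel (congrArg Subtype.val h)), ?_⟩
    rintro ⟨w, hw⟩
    obtain ⟨x, hx⟩ := exists_conePosition (p := w - v) (sub_ne_zero.mpr hw)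
    exact ⟨x, Subtype.ext (by simp [hx])⟩

lemma exists_coneEdgeEquiv (hk : 3 ≤ k) (hN : 3 ≤ N) (v : ZMod k × ZMod N) :
    ∃ ε : Fin 3 ⊕ KeptEdge k N ≃
        (((cycleGraph' k).boxProd (cycleGraph' N)).induce {w | w ≠ v}).edgeSet,
      ∀ e, (ε e : Sym2 {w | w ≠ v}) = s(coneVertexEquiv hk v (coneSource keptSource e),
        coneVertexEquiv hk v (coneTarget keptTarget (starNeighbor hk hN) e)) := by
  have hval : ∀ x, (coneVertexEquiv hk v x).1 = v + conePosition x := fun _ => rfl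
  set f : Fin 3 ⊕ KeptEdge k N → Sym2 {w | w ≠ v} := fun e =>
    s(coneVertexEquiv hk v (coneSource keptSource e),
        coneVertexEquiv hk v (coneTarget keptTarget (starNeighbor hk hN) e)) with hf
  have hmap : ∀ e, (f e).map Subtype.val = (s((coneEdge e).2,
      (coneEdge e).2 + torusStep k N (coneEdge e).1)).map (v + ·) := fun e => by
    rw [← coneEdge_ends hk hN]
    rfl
  have hinj : Function.Injective f := fun e e' h => by
    have h1 := congrArg (Sym2.map Subtype.val) h
    rw [hmap, hmap] at h1
    exact coneEdge_injective hN (torus_edge_injective hk hN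
      (Sym2.map.injective (add_right_injective v) h1))
  have hrange : ∀ z, z ∈ (((cycleGraph' k).boxProd (cycleGraph' N)).induce
      {w | w ≠ v}).edgeSet ↔ ∃ e, f e = z := by
    intro z
    have hz : z ∈ (((cycleGraph' k).boxProd (cycleGraph' N)).induce {w | w ≠ v}).edgeSet ↔
        z.map Subtype.val ∈ ((cycleGraph' k).boxProd (cycleGraph' N)).edgeSet := by
      induction z with | _ x y => rfl
    rw [hz]
    constructor
    · intro h
      have h1 : ∃ d : Bool × (ZMod k × ZMod N),
          z.map Subtype.val = s(v + d.2, v + (d.2 + torusStep k N d.1)) := by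
        induction z with | _ x y =>
        rw [Sym2.map_mk, SimpleGraph.mem_edgeSet, torus_adj hk hN] at h
        obtain ⟨b, h | h⟩ := h
        · exact ⟨(b, x.1 - v), by simp [← add_assoc, h]⟩
        · exact ⟨(b, y.1 - v), by simp [← add_assoc, h, Sym2.eq_swap]⟩
      obtain ⟨d, hd⟩ := h1
      have hne : ∀ p, p ∈ z.map Subtype.val → p ≠ v := by
        intro p hp
        obtain ⟨w, -, rfl⟩ := Sym2.mem_map.mp hp
        exact w.2
      rw [hd] at hne
      obtain ⟨e, he⟩ := exists_coneEdge d (by simpa using hne _ (Sym2.mem_mk_left _ _))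
        (by simpa using hne _ (Sym2.mem_mk_right _ _))
      refine ⟨e, Sym2.map.injective Subtype.val_injective ?_⟩
      rw [hmap, hd, he]
      rfl
    · rintro ⟨e, rfl⟩
      rw [hmap, Sym2.map_mk, SimpleGraph.mem_edgeSet, torus_adj hk hN]
      exact ⟨_, Or.inl (add_assoc _ _ _).symm⟩
  refine ⟨Equiv.ofBijective (fun e => ⟨f e, (hrange _).mpr ⟨e, rfl⟩⟩) ⟨fun e e' h =>
    hinj (congrArg Subtype.val h), ?_⟩, fun _ => rfl⟩
  rintro ⟨z, hz⟩
  obtain ⟨e, he⟩ := (hrange z).mp hz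
  exact ⟨e, Subtype.ext he⟩

end TorusGraph

/-- For a decompleted non-skew toroidal grid built from N-cycles, `[Ψ_G]_2 ≡ 0 (mod 8)`,
i.e. `c₂^{(2)}(G) = 0`. -/
theorem c2_two_decompleted_nonskew_torus_eq_zero (N k : ℕ) [NeZero N] [NeZero k]
    (hN : 3 ≤ N) (hk : 3 ≤ k) (v : ZMod k × ZMod N) :
    zeroCount (((cycleGraph' k).boxProd (cycleGraph' N)).induce {w | w ≠ v}) 2 % 8 = 0 := by
  refine Nat.mod_eq_zero_of_dvd ?_
  obtain ⟨ε, hε⟩ := exists_coneEdgeEquiv hk hN v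
  rw [zeroCount_cone (starNeighbor_injective hk hN) hε]
  have hfold : ∀ e : KeptEdge k N,
      (foldVertex (keptSource (edgeReflect e)) = foldVertex (keptSource e) ∧
        foldVertex (keptTarget (edgeReflect e)) = foldVertex (keptTarget e)) ∨
      (foldVertex (keptSource (edgeReflect e)) = foldVertex (keptTarget e) ∧
        foldVertex (keptTarget (edgeReflect e)) = foldVertex (keptSource e)) := fun e => by
    rcases ends_edgeReflect e with ⟨h1, h2⟩ | ⟨h1, h2⟩ <;>
      simp [h1, h2, foldVertex_keptReflect]
  refine eight_dvd_card_starPoly_eq_zero edgeReflect_involutive keptReflect_involutive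
    ends_edgeReflect (starNeighbor_injective hk hN) rfl ?_ ?_ ?_
  · exact Subtype.ext (Prod.ext rfl (neg_neg 1))
  · exact Subtype.ext (Prod.ext rfl neg_zero)
  · intro S hS S' hS' hτ hτ'
    exact rootedForests_inter_nonempty foldVertex_surjective (foldedEdge hN) hfold
      (exists_foldedEdge hN) (card_folded_lt hk hN) hS hS' hτ hτ'
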